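/- Fix strictly increasing α, β : ℚ → ℚ with α x < β x < α (x + ε) for all x and all ε > 0, and let mx be the induced operation. Let n ≥ 1 and b, b' : Fin n → ℚ be such that the minimum value of b is strictly less than the minimum value of b'. Then the min-set of (fun i => mx (b i) (b' i)) equals the min-set of b. -/

import Mathlib

/-- The operation `mx` induced by unary operations `α`, `β`. -/
def mxOp (α β : ℚ → ℚ) : ℚ → ℚ → ℚ :=
  fun x y => if x = y then β x else α (min x y)

/-- The set of coordinates at which a tuple attains its minimum value. -/
def minSet {n : ℕ} (b : Fin n → ℚ) : Set (Fin n) := {i | ∀ j, b i ≤ b j}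

theorem mxOp_of_lt {α β : ℚ → ℚ} {x y : ℚ} (h : x < y) : mxOp α β x y = α x := by
  simp [mxOp, h.ne, min_eq_left h.le]

theorem lt_mxOp {α β : ℚ → ℚ} (hα : StrictMono α) (hαβ : ∀ x, α x < β x) {m x y : ℚ}
    (hx : m < x) (hy : m < y) : α m < mxOp α β x y := by
  unfold mxOp
  split_ifs
  · exact (hα hx).trans (hαβ x)
  · exact hα (lt_min hx hy)

theorem mx_minSet_smaller_minimum {n : ℕ} (α β : ℚ → ℚ)
    (hα : StrictMono α) (hβ : StrictMono β)
    (hαβ : ∀ x ε : ℚ, 0 < ε → α x < β x ∧ β x < α (x + ε))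
    (hn : 1 ≤ n) (b b' : Fin n → ℚ)
    (hlt : ∃ i ∈ minSet b, ∀ j, b i < b' j) :
    minSet (fun i => mxOp α β (b i) (b' i)) = minSet b := by
  obtain ⟨i₀, hi₀, hb'⟩ := hlt
  have hmin : mxOp α β (b i₀) (b' i₀) = α (b i₀) := mxOp_of_lt (hb' i₀)
  have hlt' : ∀ j, b i₀ < b j → α (b i₀) < mxOp α β (b j) (b' j) := fun j hj =>
    lt_mxOp hα (fun x => (hαβ x 1 one_pos).1) hj (hb' j)
  have heq : ∀ j, b j = b i₀ → mxOp α β (b j) (b' j) = α (b i₀) := fun j hj => by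
    rw [hj, mxOp_of_lt (hb' j)]
  ext i
  constructor
  · intro hi j
    refine le_trans (not_lt.mp fun h => ?_) (hi₀ j)
    exact (hlt' i h).not_ge ((hi i₀).trans_eq hmin)
  · intro hi j
    refine (heq i ((hi i₀).antisymm (hi₀ i))).trans_le ?_
    rcases (hi₀ j).lt_or_eq with h | h
    · exact (hlt' j h).le
    · exact (heq j h.symm).ge
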